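/- arXiv:2510.01509 — 5 statements merged into one kernel-verified Lean document; each statement's English description precedes it below -/
import Mathlib

section
/- For every ε > 0 there exists K such that for every integer k ≥ K and every integer n ≥ 1, every 2-semi-intersecting family with parameters n and k has size at most ⌊n/k⌋ + (1 + ε)·k·C(2k,k) (where C(2k,k) denotes the central binomial coefficient). -/
/-- A 2-semi-intersecting family with parameters `n` and `k`. -/
def IsSemiIntersecting2 {α : Type*} [DecidableEq α] (n k : ℕ)
    (A B : Finset α) (𝒮 : Finset (Finset α)) : Prop :=
  Disjoint A B ∧ A.card = n ∧ B.card = n ∧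
  (∀ S ∈ 𝒮, S ⊆ A ∪ B) ∧
  (∀ S ∈ 𝒮, (S ∩ A).card = k ∧ (S ∩ B).card = k) ∧
  (∀ S ∈ 𝒮, ∀ T ∈ 𝒮, S ≠ T → Xor' (S ∩ T ∩ A = ∅) (S ∩ T ∩ B = ∅))

section

open Finset

/-- In the numbering `σ`, every element of `S` comes before every element of `T`. -/
def Numbering.Precedes {β : Type*} [Fintype β] (σ : Numbering β) (S T : Finset β) : Prop :=
  ∀ a ∈ S, ∀ b ∈ T, σ a < σ b

instance {β : Type*} [Fintype β] (σ : Numbering β) (S T : Finset β) :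
    Decidable (σ.Precedes S T) :=
  inferInstanceAs (Decidable (∀ a ∈ S, ∀ b ∈ T, σ a < σ b))

namespace Numbering

variable {β : Type*} [Fintype β] [DecidableEq β]

lemma exists_perm_mem {S T S' T' : Finset β} (h : Disjoint S T) (h' : Disjoint S' T')
    (hS : #S = #S') (hT : #T = #T') :
    ∃ π : Equiv.Perm β, (∀ a ∈ S, π a ∈ S') ∧ ∀ b ∈ T, π b ∈ T' := by
  let e : {x // x ∈ S ∪ T} ≃ {x // x ∈ S' ∪ T'} :=
    (Equiv.Finset.union S T h).symm.trans
      (((Finset.equivOfCardEq hS).sumCongr (Finset.equivOfCardEq hT)).trans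
        (Equiv.Finset.union S' T' h'))
  refine ⟨e.extendSubtype, fun a ha ↦ ?_, fun b hb ↦ ?_⟩
  · rw [e.extendSubtype_apply_of_mem a (mem_union_left _ ha)]
    simp [e, Equiv.Finset.union_symm_left h ha]
  · rw [e.extendSubtype_apply_of_mem b (mem_union_right _ hb)]
    simp [e, Equiv.Finset.union_symm_right h hb]

lemma card_precedes_le {S T S' T' : Finset β} (h : Disjoint S T) (h' : Disjoint S' T')
    (hS : #S = #S') (hT : #T = #T') :
    #{σ : Numbering β | σ.Precedes S' T'} ≤ #{σ : Numbering β | σ.Precedes S T} := by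
  obtain ⟨π, hπS, hπT⟩ := exists_perm_mem h h' hS hT
  refine card_le_card_of_injOn (fun σ ↦ π.trans σ) (fun σ hσ ↦ ?_) (fun σ _ τ _ hστ ↦ ?_)
  · simp only [coe_filter, mem_univ, true_and, Set.mem_ofPred_eq] at hσ ⊢
    exact fun a ha b hb ↦ hσ _ (hπS a ha) _ (hπT b hb)
  · ext x
    simpa using congrArg Fin.val (DFunLike.congr_fun hστ (π.symm x))

lemma exists_precedes_sdiff (σ : Numbering β) (C : Finset β) {s : ℕ} (hs : s ≤ #C) :
    ∃ S ∈ C.powersetCard s, σ.Precedes S (C \ S) := by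
  induction s with
  | zero => exact ⟨∅, by simp, by simp [Precedes]⟩
  | succ s ih =>
    obtain ⟨S, hS, hσ⟩ := ih (by omega)
    obtain ⟨hSC, hcard⟩ := mem_powersetCard.1 hS
    have hne : (C \ S).Nonempty := by
      rw [← card_pos, card_sdiff_of_subset hSC]
      omega
    obtain ⟨m, hm, hmin⟩ := exists_min_image (C \ S) σ hne
    obtain ⟨hmC, hmS⟩ := mem_sdiff.1 hm
    refine ⟨insert m S, mem_powersetCard.2 ⟨insert_subset hmC hSC, by
      rw [card_insert_of_notMem hmS, hcard]⟩, fun a ha b hb ↦ ?_⟩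
    obtain ⟨hbC, hbS⟩ := mem_sdiff.1 hb
    rw [mem_insert, not_or] at hbS
    have hb' : b ∈ C \ S := mem_sdiff.2 ⟨hbC, hbS.2⟩
    rcases mem_insert.1 ha with rfl | ha
    · exact lt_of_le_of_ne (hmin b hb') fun h ↦ hbS.1 (σ.injective h).symm
    · exact hσ a ha b hb'

lemma eq_of_precedes_sdiff (σ : Numbering β) {C S S' : Finset β} (hS : S ⊆ C) (hS' : S' ⊆ C)
    (hcard : #S = #S') (h : σ.Precedes S (C \ S)) (h' : σ.Precedes S' (C \ S')) : S = S' := by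
  by_contra hne
  obtain ⟨a, ha, ha'⟩ := not_subset.1 fun hsub ↦ hne (eq_of_subset_of_card_le hsub hcard.ge)
  obtain ⟨b, hb, hb'⟩ := not_subset.1 fun hsub ↦ hne (eq_of_subset_of_card_le hsub hcard.le).symm
  exact lt_asymm (h a ha b (mem_sdiff.2 ⟨hS' hb, hb'⟩)) (h' b hb a (mem_sdiff.2 ⟨hS ha, ha'⟩))

/-- A uniformly random numbering puts `S` before `T` with probability `1 / C(#S + #T, #S)`. -/
lemma card_precedes_mul_choose {S T : Finset β} (h : Disjoint S T) :
    #{σ : Numbering β | σ.Precedes S T} * (#S + #T).choose #S = Fintype.card (Numbering β) := by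
  have key : ∀ S' ∈ (S ∪ T).powersetCard #S,
      #{σ : Numbering β | σ.Precedes S' ((S ∪ T) \ S')} = #{σ : Numbering β | σ.Precedes S T} := by
    intro S' hS'
    obtain ⟨hsub, hcard⟩ := mem_powersetCard.1 hS'
    have hT : #((S ∪ T) \ S') = #T := by
      rw [card_sdiff_of_subset hsub, card_union_of_disjoint h]
      omega
    exact (card_precedes_le h disjoint_sdiff hcard.symm hT.symm).antisymm
      (card_precedes_le disjoint_sdiff h hcard hT)
  calc _ = ∑ S' ∈ (S ∪ T).powersetCard #S,
        #{σ : Numbering β | σ.Precedes S' ((S ∪ T) \ S')} := by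
        rw [sum_congr rfl key, sum_const, card_powersetCard, card_union_of_disjoint h, smul_eq_mul,
          mul_comm]
    _ = ∑ σ : Numbering β, #{S' ∈ (S ∪ T).powersetCard #S | σ.Precedes S' ((S ∪ T) \ S')} :=
        sum_card_bipartiteAbove_eq_sum_card_bipartiteBelow
          (fun (S' : Finset β) (σ : Numbering β) ↦ σ.Precedes S' ((S ∪ T) \ S'))
    _ = ∑ σ : Numbering β, 1 := by
        refine sum_congr rfl fun σ _ ↦ card_eq_one.2 ?_
        obtain ⟨S', hS', hσ⟩ := σ.exists_precedes_sdiff (S ∪ T) (s := #S)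
          (card_le_card subset_union_left)
        refine ⟨S', eq_singleton_iff_unique_mem.2 ⟨mem_filter.2 ⟨hS', hσ⟩, fun S'' hS'' ↦ ?_⟩⟩
        obtain ⟨hS'', hσ''⟩ := mem_filter.1 hS''
        rw [mem_powersetCard] at hS' hS''
        exact σ.eq_of_precedes_sdiff hS''.1 hS'.1 (hS''.2.trans hS'.2.symm) hσ'' hσ
    _ = _ := by simp

end Numbering

/-- Two set systems `X`, `Y` of `k`-sets with the same index type such that distinct indices have
disjoint `X`-sets if and only if they have intersecting `Y`-sets. -/
structure SemiIntersectingPair {ι α β : Type*} (k : ℕ) (X : ι → Finset α) (Y : ι → Finset β) :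
    Prop where
  card_left : ∀ i, #(X i) = k
  card_right : ∀ i, #(Y i) = k
  meet_iff : ∀ i j, i ≠ j → (¬ Disjoint (X i) (X j) ↔ Disjoint (Y i) (Y j))

namespace SemiIntersectingPair

variable {ι α β : Type*} {k : ℕ} {X : ι → Finset α} {Y : ι → Finset β}

lemma symm (h : SemiIntersectingPair k X Y) : SemiIntersectingPair k Y X where
  card_left := h.card_right
  card_right := h.card_left
  meet_iff i j hij := by rw [← h.meet_iff i j hij, not_not]

variable (X) in
/-- The relation between distinct indices with intersecting sets. -/
abbrev Meets (i j : ι) : Prop := i ≠ j ∧ ¬ Disjoint (X i) (X j)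

lemma Meets.symm {i j : ι} (h : Meets X i j) : Meets X j i :=
  ⟨h.1.symm, fun hd ↦ h.2 hd.symm⟩

variable [Fintype ι] [DecidableEq ι] [DecidableEq α] [DecidableEq β]

/-- Stars of the two set systems cannot both be large. -/
lemma card_star_le_or (h : SemiIntersectingPair k X Y) (hk : 0 < k) :
    (∀ x, #{i | x ∈ X i} ≤ 2 * k) ∨ ∀ y, #{i | y ∈ Y i} ≤ 2 * k := by
  by_contra! hcon
  obtain ⟨⟨x, hx⟩, y, hy⟩ := hcon
  set C : Finset ι := {i | x ∈ X i} with hC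
  set I : Finset ι := {i | y ∈ Y i} with hI
  have hX (v : ι) : #{i ∈ I | ¬ Disjoint (X v) (X i)} ≤ k := by
    have hdisj : Set.PairwiseDisjoint (↑{i ∈ I | ¬ Disjoint (X v) (X i)}) fun i ↦ X v ∩ X i := by
      intro i hi j hj hij
      have hi' : y ∈ Y i := by simp [hI] at hi; exact hi.1
      have hj' : y ∈ Y j := by simp [hI] at hj; exact hj.1
      have : Disjoint (X i) (X j) := by
        by_contra hd
        exact disjoint_left.1 ((h.meet_iff i j hij).1 hd) hi' hj'
      exact this.mono inter_subset_right inter_subset_right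
    rw [← h.card_left v]
    refine (card_le_card_biUnion hdisj fun i hi ↦ ?_).trans
      (card_le_card (biUnion_subset.2 fun i _ ↦ inter_subset_left))
    exact not_disjoint_iff_nonempty_inter.1 (mem_filter.1 hi).2
  have hY (i : ι) : #{v ∈ C | ¬ Disjoint (Y v) (Y i)} ≤ k := by
    have hdisj : Set.PairwiseDisjoint (↑{v ∈ C | ¬ Disjoint (Y v) (Y i)}) fun v ↦ Y v ∩ Y i := by
      intro v hv w hw hvw
      have hv' : x ∈ X v := by simp [hC] at hv; exact hv.1
      have hw' : x ∈ X w := by simp [hC] at hw; exact hw.1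
      exact ((h.meet_iff v w hvw).1 (not_disjoint_iff.2 ⟨x, hv', hw'⟩)).mono
        inter_subset_left inter_subset_left
    rw [← h.card_right i]
    refine (card_le_card_biUnion hdisj fun v hv ↦ ?_).trans
      (card_le_card (biUnion_subset.2 fun v _ ↦ inter_subset_right))
    exact not_disjoint_iff_nonempty_inter.1 (mem_filter.1 hv).2
  have hpair (v i : ι) : ¬ Disjoint (X v) (X i) ∨ ¬ Disjoint (Y v) (Y i) := by
    rcases eq_or_ne v i with rfl | hvi
    · left
      rw [disjoint_self_iff_empty, ← card_eq_zero, h.card_left]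
      omega
    · by_contra! hd
      exact (h.meet_iff v i hvi).2 hd.2 hd.1
  have hcount : #C * #I ≤ #C * k + #I * k := by
    calc #C * #I = #(C ×ˢ I) := (card_product _ _).symm
      _ ≤ #({p ∈ C ×ˢ I | ¬ Disjoint (X p.1) (X p.2)} ∪
            {p ∈ C ×ˢ I | ¬ Disjoint (Y p.1) (Y p.2)}) := by
          rw [← filter_or, filter_true_of_mem fun p _ ↦ hpair p.1 p.2]
      _ ≤ _ := card_union_le _ _
      _ ≤ _ := by
          rw [card_filter, card_filter, sum_product, sum_product_right]
          simp only [← card_filter]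
          exact add_le_add (sum_le_card_nsmul _ _ _ fun v _ ↦ hX v)
            (sum_le_card_nsmul _ _ _ fun i _ ↦ hY i)
  nlinarith [mul_lt_mul'' hx hy (Nat.zero_le _) (Nat.zero_le _)]

omit [DecidableEq β] in
lemma card_meets_le (h : SemiIntersectingPair k X Y) (hX : ∀ x, #{i | x ∈ X i} ≤ 2 * k) (v : ι) :
    #{w | Meets X v w} ≤ 2 * k ^ 2 := by
  calc #{w | Meets X v w} ≤ #((X v).biUnion fun x ↦ {w | x ∈ X w}) := by
        refine card_le_card fun w hw ↦ ?_
        obtain ⟨x, hx, hx'⟩ := not_disjoint_iff.1 (mem_filter.1 hw).2.2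
        exact mem_biUnion.2 ⟨x, hx, by simpa using hx'⟩
    _ ≤ #(X v) * (2 * k) := card_biUnion_le_card_mul _ _ _ fun x _ ↦ hX x
    _ = 2 * k ^ 2 := by rw [h.card_left]; ring

omit [Fintype ι] [DecidableEq ι] [DecidableEq β] in
lemma sum_card_inter_le (h : SemiIntersectingPair k X Y) (w : ι) {F : Finset ι}
    (hF : ∀ i ∈ F, ∀ j ∈ F, i ≠ j → Disjoint (X i) (X j)) : ∑ v ∈ F, #(X v ∩ X w) ≤ k := by
  rw [← card_biUnion fun i hi j hj hij ↦
    (hF i hi j hj hij).mono inter_subset_left inter_subset_left, ← h.card_left w]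
  exact card_le_card (biUnion_subset.2 fun _ _ ↦ inter_subset_right)

omit [DecidableEq β] in
/-- A union bound on the number of indices, in terms of the pairwise intersections. -/
lemma two_mul_card_le [Fintype α] (h : SemiIntersectingPair k X Y) :
    2 * (k * Fintype.card ι) ≤
      2 * Fintype.card α + ∑ p : ι × ι with Meets X p.1 p.2, #(X p.1 ∩ X p.2) := by
  have h1 : k * Fintype.card ι = ∑ x, #{i | x ∈ X i} := by
    have := sum_card_bipartiteAbove_eq_sum_card_bipartiteBelow (s := univ) (t := univ)
      (fun (i : ι) (x : α) ↦ x ∈ X i)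
    simpa [bipartiteAbove, bipartiteBelow, h.card_left, mul_comm] using this
  have h2 : ∑ p : ι × ι with Meets X p.1 p.2, #(X p.1 ∩ X p.2) =
      ∑ x, #{i | x ∈ X i} * (#{i | x ∈ X i} - 1) := by
    calc _ = ∑ p : ι × ι with p.1 ≠ p.2, #(X p.1 ∩ X p.2) := by
          refine sum_subset (fun p hp ↦ ?_) fun p hp hp' ↦ ?_
          · simp only [mem_filter, mem_univ, true_and] at hp ⊢
            exact hp.1
          · simp only [mem_filter, mem_univ, true_and, not_and, not_not] at hp hp'
            rw [card_eq_zero]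
            exact disjoint_iff_inter_eq_empty.1 (hp' hp)
      _ = ∑ p : ι × ι with p.1 ≠ p.2, #(univ.bipartiteAbove
            (fun (p : ι × ι) (x : α) ↦ x ∈ X p.1 ∩ X p.2) p) := by
          simp only [bipartiteAbove, filter_univ_mem]
      _ = ∑ x, #{p ∈ ({p : ι × ι | p.1 ≠ p.2} : Finset _) | x ∈ X p.1 ∩ X p.2} :=
          sum_card_bipartiteAbove_eq_sum_card_bipartiteBelow _
      _ = _ := by
          refine sum_congr rfl fun x _ ↦ ?_
          rw [Nat.mul_sub_one, ← offDiag_card]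
          congr 1
          ext p
          simp [mem_offDiag]
          tauto
  rw [h1, h2, mul_sum, Fintype.card, card_eq_sum_ones, mul_sum, ← sum_add_distrib]
  refine sum_le_sum fun x _ ↦ ?_
  generalize #{i | x ∈ X i} = d
  rcases d with _ | _ | d
  · simp
  · simp
  · simp only [Nat.add_sub_cancel]
    nlinarith

variable [Fintype β]

variable (X Y) in
/-- The meeting pairs whose `Y`-sets come one before the other in the numbering `σ`. -/
def realized (σ : Numbering β) : Finset (ι × ι) :=
  {p | Meets X p.1 p.2 ∧ σ.Precedes (Y p.1) (Y p.2)}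

variable (X) in
/-- The triples of pairwise meeting indices. -/
def triangles : Finset (ι × ι × ι) :=
  {t | Meets X t.1 t.2.1 ∧ Meets X t.1 t.2.2 ∧ Meets X t.2.1 t.2.2}

omit [DecidableEq β] in
/-- All realized pairs can be found among the neighbours of a single index. -/
lemma exists_realized_subset (h : SemiIntersectingPair k X Y) (hk : 0 < k) (σ : Numbering β)
    (hne : (realized X Y σ).Nonempty) :
    ∃ u, ∀ p ∈ realized X Y σ, Meets X u p.2 ∧ σ.Precedes (Y u) (Y p.2) := by
  have hY (i : ι) : (Y i).Nonempty := card_pos.1 (by rw [h.card_right]; exact hk)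
  obtain ⟨q, hq, hmin⟩ := exists_min_image _ (fun p : ι × ι ↦ (Y p.1).sup' (hY p.1) σ) hne
  refine ⟨q.1, fun p hp ↦ ?_⟩
  have hpσ := (mem_filter.1 hp).2.2
  have hprec : σ.Precedes (Y q.1) (Y p.2) := fun a ha b hb ↦
    ((le_sup' σ ha).trans (hmin p hp)).trans_lt
      ((sup'_lt_iff (hY p.1)).2 fun c hc ↦ hpσ c hc b hb)
  have hdisj : Disjoint (Y q.1) (Y p.2) :=
    disjoint_left.2 fun a ha hb ↦ lt_irrefl _ (hprec a ha a hb)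
  have hqp : q.1 ≠ p.2 := by
    intro heq
    rw [heq, disjoint_self_iff_empty] at hdisj
    exact (hY p.2).ne_empty hdisj
  exact ⟨⟨hqp, (h.meet_iff _ _ hqp).2 hdisj⟩, hprec⟩

omit [DecidableEq β] in
lemma sum_realized_le (σ : Numbering β) {T : Finset ι}
    {c : ℕ} (hT : ∀ p ∈ realized X Y σ, p.2 ∈ T)
    (hc : ∀ w ∈ T, ∑ v with Meets X v w ∧ σ.Precedes (Y v) (Y w), #(X v ∩ X w) ≤ c) :
    ∑ p ∈ realized X Y σ, #(X p.1 ∩ X p.2) ≤ #T * c := by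
  calc ∑ p ∈ realized X Y σ, #(X p.1 ∩ X p.2)
      = ∑ w ∈ T, ∑ p ∈ realized X Y σ with p.2 = w, #(X p.1 ∩ X p.2) :=
        (sum_fiberwise_of_maps_to hT _).symm
    _ ≤ ∑ w ∈ T, c := by
        refine sum_le_sum fun w hw ↦ le_trans (le_of_eq ?_) (hc w hw)
        refine sum_nbij' Prod.fst (fun v ↦ (v, w)) ?_ ?_ ?_ ?_ ?_
        · rintro ⟨v, w'⟩ hp
          simp only [realized, mem_filter, mem_univ, true_and] at hp ⊢
          exact hp.2 ▸ hp.1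
        · intro v hv
          simpa [realized] using hv
        · rintro ⟨v, w'⟩ hp
          simp only [mem_filter] at hp
          simp [hp.2]
        · simp
        · rintro ⟨v, w'⟩ hp
          simp only [mem_filter] at hp
          simp [hp.2]
    _ = #T * c := by simp

omit [DecidableEq β] in
lemma sum_realized_le_of_card_meets_le (h : SemiIntersectingPair k X Y) (hk : 0 < k)
    (σ : Numbering β) {d : ℕ} (hd : ∀ v, #{w | Meets X v w} ≤ d) :
    ∑ p ∈ realized X Y σ, #(X p.1 ∩ X p.2) ≤ d ^ 2 * k := by
  rcases (realized X Y σ).eq_empty_or_nonempty with he | hne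
  · simp [he]
  obtain ⟨u, hu⟩ := h.exists_realized_subset hk σ hne
  calc _ ≤ #{w | Meets X u w} * (d * k) := by
        refine sum_realized_le σ (fun p hp ↦ by simpa using (hu p hp).1) fun w _ ↦ ?_
        calc _ ≤ #{v | Meets X v w ∧ σ.Precedes (Y v) (Y w)} * k :=
              sum_le_card_nsmul _ _ _ fun v _ ↦
                (card_le_card inter_subset_left).trans (h.card_left v).le
          _ ≤ d * k := by
              gcongr
              refine (card_le_card fun v hv ↦ ?_).trans (hd w)
              simp only [mem_filter, mem_univ, true_and] at hv ⊢
              exact hv.1.symm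
    _ ≤ d * (d * k) := by gcongr; exact hd u
    _ = d ^ 2 * k := by ring

lemma sum_realized_le_of_forall_triangles (h : SemiIntersectingPair k X Y) (hk : 0 < k)
    (σ : Numbering β)
    (hσ : ∀ t ∈ triangles X, ¬ σ.Precedes (Y t.1) (Y t.2.1 ∪ Y t.2.2))
    (hσ' : ∀ t ∈ triangles X, ¬ σ.Precedes (Y t.2.1 ∪ Y t.2.2) (Y t.1)) :
    ∑ p ∈ realized X Y σ, #(X p.1 ∩ X p.2) ≤ k ^ 2 := by
  rcases (realized X Y σ).eq_empty_or_nonempty with he | hne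
  · simp [he]
  obtain ⟨u, hu⟩ := h.exists_realized_subset hk σ hne
  set T : Finset ι := {w | Meets X u w ∧ σ.Precedes (Y u) (Y w)} with hT
  have hTk : #T ≤ k := by
    refine le_trans ?_ (h.sum_card_inter_le u (F := T) fun i hi j hj hij ↦ ?_)
    · rw [card_eq_sum_ones]
      refine sum_le_sum fun w hw ↦ ?_
      exact card_pos.2 (not_disjoint_iff_nonempty_inter.1 (mem_filter.1 hw).2.1.symm.2)
    · obtain ⟨hi, hiσ⟩ := (mem_filter.1 hi).2
      obtain ⟨hj, hjσ⟩ := (mem_filter.1 hj).2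
      by_contra hd
      refine hσ (u, i, j) (by simpa [triangles] using ⟨hi, hj, hij, hd⟩) fun a ha b hb ↦ ?_
      exact (mem_union.1 hb).elim (hiσ a ha b) (hjσ a ha b)
  calc _ ≤ #T * k := by
        refine sum_realized_le σ (fun p hp ↦ by simpa [hT] using hu p hp) fun w _ ↦ ?_
        refine h.sum_card_inter_le w fun i hi j hj hij ↦ ?_
        obtain ⟨hi, hiσ⟩ := (mem_filter.1 hi).2
        obtain ⟨hj, hjσ⟩ := (mem_filter.1 hj).2
        by_contra hd
        refine hσ' (w, i, j) ?_ fun a ha b hb ↦ ?_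
        · simpa [triangles] using ⟨hi.symm, hj.symm, hij, hd⟩
        · exact (mem_union.1 ha).elim (fun ha ↦ hiσ a ha b hb) (fun ha ↦ hjσ a ha b hb)
    _ ≤ k ^ 2 := by rw [sq]; gcongr

omit [DecidableEq β] [Fintype β] in
lemma card_triangles_le {d : ℕ} (hd : ∀ v, #{w | Meets X v w} ≤ d) :
    #(triangles X) ≤ (∑ p : ι × ι with Meets X p.1 p.2, #(X p.1 ∩ X p.2)) * d := by
  have hmaps : ∀ t ∈ triangles X, (t.1, t.2.1) ∈ ({p | Meets X p.1 p.2} : Finset (ι × ι)) := by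
    intro t ht
    simpa using (mem_filter.1 ht).2.1
  rw [card_eq_sum_card_fiberwise hmaps, sum_mul]
  refine sum_le_sum fun p hp ↦ ?_
  have hpos : 1 ≤ #(X p.1 ∩ X p.2) :=
    card_pos.2 (not_disjoint_iff_nonempty_inter.1 (mem_filter.1 hp).2.2)
  calc _ ≤ #{w | Meets X p.1 w} := by
        refine card_le_card_of_injOn (fun t ↦ t.2.2) (fun t ht ↦ ?_) fun t ht s hs hts ↦ ?_
        · simp only [triangles, coe_filter, mem_filter, mem_univ, true_and,
            Set.mem_ofPred_eq] at ht ⊢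
          rw [← ht.2]
          exact ht.1.2.1
        · simp only [triangles, coe_filter, mem_filter, mem_univ, true_and,
            Set.mem_ofPred_eq] at ht hs
          have := ht.2.trans hs.2.symm
          simp only [Prod.mk.injEq] at this
          exact Prod.ext this.1 (Prod.ext this.2 hts)
    _ ≤ d := hd _
    _ ≤ _ := Nat.le_mul_of_pos_left _ hpos

/-- Counting realized pairs over all numberings. -/
lemma sum_mul_le (h : SemiIntersectingPair k X Y) (hk : 0 < k) {d : ℕ}
    (hd : ∀ v, #{w | Meets X v w} ≤ d) {W : ℕ}
    (hW : W = ∑ p : ι × ι with Meets X p.1 p.2, #(X p.1 ∩ X p.2)) :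
    (W : ℝ) / (2 * k).choose k ≤ k ^ 2 + 2 * W * d ^ 3 * k / (3 * k).choose k := by
  have hM : (0 : ℝ) < Fintype.card (Numbering β) := by
    have : 0 < Fintype.card (Numbering β) := by simp [Nat.factorial_pos]
    exact_mod_cast this
  set M : ℕ := Fintype.card (Numbering β) with hMdef
  have hN : (0 : ℝ) < (2 * k).choose k := by exact_mod_cast Nat.choose_pos (by omega)
  have hN' : (0 : ℝ) < (3 * k).choose k := by exact_mod_cast Nat.choose_pos (by omega)
  have hdisj {i j : ι} (hij : Meets X i j) : Disjoint (Y i) (Y j) := (h.meet_iff i j hij.1).1 hij.2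
  have hedge (p : ι × ι) (hp : Meets X p.1 p.2) :
      (#{σ : Numbering β | σ.Precedes (Y p.1) (Y p.2)} : ℝ) = M / (2 * k).choose k := by
    rw [eq_div_iff hN.ne', hMdef, ← Numbering.card_precedes_mul_choose (hdisj hp), h.card_right,
      h.card_right, ← two_mul]
    push_cast
    rfl
  have htri (t : ι × ι × ι) (ht : t ∈ triangles X) :
      Disjoint (Y t.1) (Y t.2.1 ∪ Y t.2.2) ∧ #(Y t.2.1 ∪ Y t.2.2) = 2 * k := by
    obtain ⟨h1, h2, h3⟩ := (mem_filter.1 ht).2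
    refine ⟨disjoint_union_right.2 ⟨hdisj h1, hdisj h2⟩, ?_⟩
    rw [card_union_of_disjoint (hdisj h3), h.card_right, h.card_right, two_mul]
  have htri1 (t : ι × ι × ι) (ht : t ∈ triangles X) :
      (#{σ : Numbering β | σ.Precedes (Y t.1) (Y t.2.1 ∪ Y t.2.2)} : ℝ) =
        M / (3 * k).choose k := by
    rw [eq_div_iff hN'.ne', hMdef, ← Numbering.card_precedes_mul_choose (htri t ht).1, h.card_right,
      (htri t ht).2, show k + 2 * k = 3 * k by ring]
    push_cast
    rfl
  have htri2 (t : ι × ι × ι) (ht : t ∈ triangles X) :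
      (#{σ : Numbering β | σ.Precedes (Y t.2.1 ∪ Y t.2.2) (Y t.1)} : ℝ) =
        M / (3 * k).choose k := by
    rw [eq_div_iff hN'.ne', hMdef, ← Numbering.card_precedes_mul_choose (htri t ht).1.symm,
      h.card_right, (htri t ht).2, show 2 * k + k = 3 * k by ring,
      Nat.choose_symm_of_eq_add (show 3 * k = 2 * k + k by ring)]
    push_cast
    rfl
  have hpoint (σ : Numbering β) : (∑ p ∈ realized X Y σ, #(X p.1 ∩ X p.2)) ≤
      k ^ 2 + (#{t ∈ triangles X | σ.Precedes (Y t.1) (Y t.2.1 ∪ Y t.2.2)} +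
        #{t ∈ triangles X | σ.Precedes (Y t.2.1 ∪ Y t.2.2) (Y t.1)}) * (d ^ 2 * k) := by
    by_cases hbad : (∀ t ∈ triangles X, ¬ σ.Precedes (Y t.1) (Y t.2.1 ∪ Y t.2.2)) ∧
      ∀ t ∈ triangles X, ¬ σ.Precedes (Y t.2.1 ∪ Y t.2.2) (Y t.1)
    · exact (h.sum_realized_le_of_forall_triangles hk σ hbad.1 hbad.2).trans (Nat.le_add_right _ _)
    · refine ((h.sum_realized_le_of_card_meets_le hk σ hd).trans
        (Nat.le_mul_of_pos_left _ ?_)).trans (Nat.le_add_left _ _)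
      by_contra! h0
      simp only [Nat.le_zero, Nat.add_eq_zero_iff, card_eq_zero, filter_eq_empty_iff] at h0
      exact hbad ⟨fun t ht ↦ h0.1 ht, fun t ht ↦ h0.2 ht⟩
  have hleft : ((∑ σ : Numbering β, ∑ p ∈ realized X Y σ, #(X p.1 ∩ X p.2) : ℕ) : ℝ) =
      W * (M / (2 * k).choose k) := by
    have hfilter (σ : Numbering β) : realized X Y σ =
        {p ∈ ({p | Meets X p.1 p.2} : Finset (ι × ι)) | σ.Precedes (Y p.1) (Y p.2)} :=
      (filter_filter _ _ _).symm
    simp only [hfilter, sum_filter (s := filter _ _)]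
    rw [sum_comm, hW]
    push_cast
    rw [sum_mul]
    refine sum_congr rfl fun p hp ↦ ?_
    rw [← hedge p (mem_filter.1 hp).2, ← sum_filter, sum_const, nsmul_eq_mul, mul_comm]
  have hright (P : Numbering β → ι × ι × ι → Prop) [∀ σ t, Decidable (P σ t)]
      (hP : ∀ t ∈ triangles X, (#{σ | P σ t} : ℝ) = M / (3 * k).choose k) :
      ((∑ σ : Numbering β, #{t ∈ triangles X | P σ t} : ℕ) : ℝ) =
        #(triangles X) * (M / (3 * k).choose k) := by
    have := sum_card_bipartiteAbove_eq_sum_card_bipartiteBelow (s := univ) (t := triangles X) P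
    simp only [bipartiteAbove, bipartiteBelow] at this
    rw [this]
    push_cast
    rw [sum_congr rfl hP, sum_const, nsmul_eq_mul]
  have hsum := sum_le_sum fun σ (_ : σ ∈ (univ : Finset (Numbering β))) ↦ hpoint σ
  rw [sum_add_distrib, ← sum_mul, sum_add_distrib, sum_const, card_univ, ← hMdef,
    smul_eq_mul] at hsum
  have hsum' := (Nat.cast_le (α := ℝ)).2 hsum
  rw [hleft, Nat.cast_add, Nat.cast_mul, Nat.cast_mul, Nat.cast_add, hright _ htri1,
    hright _ htri2] at hsum'
  have htriW : (#(triangles X) : ℝ) ≤ W * d := by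
    rw [hW]
    exact_mod_cast card_triangles_le hd
  have hfin : W * ((M : ℝ) / (2 * k).choose k) ≤
      M * k ^ 2 + (W * d * (M / (3 * k).choose k) + W * d * (M / (3 * k).choose k)) *
        (d ^ 2 * k) := by
    refine hsum'.trans ?_
    push_cast
    gcongr
  refine le_of_mul_le_mul_left ?_ hM
  calc _ = W * ((M : ℝ) / (2 * k).choose k) := by ring
    _ ≤ _ := hfin
    _ = _ := by ring

lemma three_pow_mul_choose_le {k j : ℕ} (hj : j ≤ k) :
    3 ^ j * (2 * k).choose k ≤ 2 ^ j * (2 * k + j).choose k := by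
  induction j with
  | zero => simp
  | succ j ih =>
    have hrec := Nat.choose_mul_succ_eq (2 * k + j) k
    rw [show 2 * k + j + 1 - k = k + j + 1 by omega] at hrec
    refine le_of_mul_le_mul_right ?_ (show 0 < k + j + 1 by omega)
    calc 3 ^ (j + 1) * (2 * k).choose k * (k + j + 1)
        = 3 ^ j * (2 * k).choose k * (3 * (k + j + 1)) := by ring
      _ ≤ 2 ^ j * (2 * k + j).choose k * (2 * (2 * k + j + 1)) :=
          Nat.mul_le_mul (ih (by omega)) (by omega)
      _ = 2 ^ (j + 1) * ((2 * k + j).choose k * (2 * k + j + 1)) := by ring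
      _ = 2 ^ (j + 1) * (2 * k + (j + 1)).choose k * (k + j + 1) := by
          rw [hrec, ← add_assoc]; ring

lemma eventually_mul_choose_le :
    ∀ᶠ k : ℕ in Filter.atTop, 64 * (k : ℝ) ^ 7 * (2 * k).choose k ≤ (3 * k).choose k := by
  have hlim := tendsto_pow_const_mul_const_pow_of_lt_one 7
    (show (0 : ℝ) ≤ 2 / 3 by norm_num) (by norm_num)
  filter_upwards [hlim.eventually_le_const (show (0 : ℝ) < 1 / 64 by norm_num)] with k hk
  have h := three_pow_mul_choose_le (le_refl k)
  rw [show 2 * k + k = 3 * k by ring] at h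
  have h' : (3 : ℝ) ^ k * (2 * k).choose k ≤ 2 ^ k * (3 * k).choose k := by exact_mod_cast h
  rw [div_pow, mul_div_assoc', div_le_iff₀ (by positivity)] at hk
  refine le_of_mul_le_mul_left ?_ (show (0 : ℝ) < 2 ^ k by positivity)
  calc _ = 64 * ((k : ℝ) ^ 7 * 2 ^ k) * (2 * k).choose k := by ring
    _ ≤ 64 * (1 / 64 * 3 ^ k) * (2 * k).choose k := by gcongr
    _ = 3 ^ k * (2 * k).choose k := by ring
    _ ≤ _ := h'

/-- The bound on the number of indices when the stars of `X` are small. -/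
lemma card_le_of_card_star_le [Fintype α] (h : SemiIntersectingPair k X Y) (hk : 3 ≤ k)
    (hX : ∀ x, #{i | x ∈ X i} ≤ 2 * k)
    (hchoose : 64 * (k : ℝ) ^ 7 * (2 * k).choose k ≤ (3 * k).choose k) :
    (Fintype.card ι : ℝ) ≤ (Fintype.card α / k : ℕ) + k * (2 * k).choose k := by
  obtain ⟨W, hW⟩ : ∃ W : ℕ, W = ∑ p : ι × ι with Meets X p.1 p.2, #(X p.1 ∩ X p.2) := ⟨_, rfl⟩
  have hmain := h.sum_mul_le (by omega) (h.card_meets_le hX) hW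
  have hcard : (2 : ℝ) * (k * Fintype.card ι) ≤ 2 * Fintype.card α + W := by
    exact_mod_cast hW ▸ h.two_mul_card_le
  have hk' : (3 : ℝ) ≤ k := by exact_mod_cast hk
  have hN : (1 : ℝ) ≤ (2 * k).choose k := by
    exact_mod_cast Nat.choose_pos (show k ≤ 2 * k by omega)
  have hN' : (0 : ℝ) < (3 * k).choose k := by
    exact_mod_cast Nat.choose_pos (show k ≤ 3 * k by omega)
  generalize ((2 * k).choose k : ℝ) = N at *
  generalize ((3 * k).choose k : ℝ) = N' at *
  have hfloor : (Fintype.card α : ℝ) ≤ k * ((Fintype.card α / k : ℕ) + 1) := by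
    exact_mod_cast (Nat.lt_mul_div_succ (Fintype.card α) (show 0 < k by omega)).le
  have herr : 2 * W * ((2 * k ^ 2 : ℕ) : ℝ) ^ 3 * k / N' ≤ W / (4 * N) := by
    rw [div_le_div_iff₀ hN' (by positivity)]
    push_cast
    calc _ = W * (64 * (k : ℝ) ^ 7 * N) := by ring
      _ ≤ W * N' := by gcongr
  have hWN : 3 * (W : ℝ) ≤ 4 * k ^ 2 * N := by
    have h1 : (W : ℝ) / N ≤ k ^ 2 + W / (4 * N) := hmain.trans (by gcongr)
    have h2 : (W : ℝ) / (4 * N) = W / N / 4 := by rw [mul_comm, div_mul_eq_div_div]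
    have h3 : (W : ℝ) / N ≤ 4 / 3 * k ^ 2 := by linarith
    rw [div_le_iff₀ (by linarith)] at h3
    linarith
  have hkN : (k : ℝ) * 3 ≤ k * (k * N) := by
    gcongr
    nlinarith
  refine le_of_mul_le_mul_left ?_ (show (0 : ℝ) < k by linarith)
  linarith

lemma card_le [Fintype α] (h : SemiIntersectingPair k X Y) (hk : 3 ≤ k)
    (hαβ : Fintype.card α = Fintype.card β)
    (hchoose : 64 * (k : ℝ) ^ 7 * (2 * k).choose k ≤ (3 * k).choose k) :
    (Fintype.card ι : ℝ) ≤ (Fintype.card α / k : ℕ) + k * (2 * k).choose k := by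
  rcases h.card_star_le_or (by omega) with hX | hY
  · exact h.card_le_of_card_star_le hk hX hchoose
  · rw [hαβ]
    exact h.symm.card_le_of_card_star_le hk hY hchoose

end SemiIntersectingPair

lemma IsSemiIntersecting2.semiIntersectingPair {α : Type*} [DecidableEq α] {n k : ℕ}
    {A B : Finset α} {𝒮 : Finset (Finset α)} (h : IsSemiIntersecting2 n k A B 𝒮) :
    SemiIntersectingPair k (fun S : 𝒮 ↦ S.1.subtype (· ∈ A)) (fun S : 𝒮 ↦ S.1.subtype (· ∈ B)) := by
  obtain ⟨-, -, -, -, hcard, hxor⟩ := h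
  have hdisj (C S T : Finset α) :
      Disjoint (S.subtype (· ∈ C)) (T.subtype (· ∈ C)) ↔ S ∩ T ∩ C = ∅ := by
    simp only [disjoint_left, mem_subtype, Subtype.forall, eq_empty_iff_forall_notMem, mem_inter]
    exact ⟨fun h a ha ↦ h a ha.2 ha.1.1 ha.1.2, fun h a hC hS hT ↦ h a ⟨⟨hS, hT⟩, hC⟩⟩
  refine ⟨fun S ↦ ?_, fun S ↦ ?_, fun S T hST ↦ ?_⟩
  · rw [card_subtype, filter_mem_eq_inter, (hcard S.1 S.2).1]
  · rw [card_subtype, filter_mem_eq_inter, (hcard S.1 S.2).2]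
  · rw [hdisj, hdisj]
    exact xor_iff_not_iff'.1 (hxor S.1 S.2 T.1 T.2 (Subtype.coe_ne_coe.2 hST))

end

/-- For every `ε > 0` there is `K` such that for all `k ≥ K` and `n ≥ 1`, every
2-semi-intersecting family with parameters `n` and `k` has size at most
`⌊n/k⌋ + (1 + ε)·k·C(2k,k)`. -/
theorem stmt_1 :
    ∀ ε : ℝ, 0 < ε → ∃ K : ℕ, ∀ k : ℕ, K ≤ k → ∀ n : ℕ, 1 ≤ n →
      ∀ (α : Type) [DecidableEq α], ∀ (A B : Finset α) (𝒮 : Finset (Finset α)),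
        IsSemiIntersecting2 n k A B 𝒮 →
        (𝒮.card : ℝ) ≤ ((n / k : ℕ) : ℝ) + (1 + ε) * k * Nat.choose (2 * k) k := by
  intro ε hε
  obtain ⟨K, hK⟩ := Filter.eventually_atTop.1 SemiIntersectingPair.eventually_mul_choose_le
  refine ⟨max K 3, fun k hk n _ α _ A B 𝒮 h ↦ ?_⟩
  have hA := h.2.1
  have hB := h.2.2.1
  have hle := h.semiIntersectingPair.card_le (le_of_max_le_right hk) (by simp [hA, hB])
    (hK k (le_of_max_le_left hk))
  rw [Fintype.card_coe, Fintype.card_coe, hA] at hle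
  refine hle.trans ?_
  have : 0 ≤ ε * (k * (2 * k).choose k : ℝ) := by positivity
  linarith
end

section
/- Let 𝒮 be a 2-semi-intersecting family with parameters n and k and base sets A and B. If |𝒮| > 2k³, then either every element of A is contained in at most k members of 𝒮, or every element of B is contained in at most k members of 𝒮. -/
namespace IsSemiIntersecting2

variable {α : Type*} [DecidableEq α] {n k : ℕ} {A B : Finset α} {𝒮 : Finset (Finset α)}

theorem symm (h : IsSemiIntersecting2 n k A B 𝒮) : IsSemiIntersecting2 n k B A 𝒮 := by
  obtain ⟨hAB, hA, hB, hsub, hk, hx⟩ := h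
  refine ⟨hAB.symm, hB, hA, fun S hS => ?_, fun S hS => (hk S hS).symm, fun S hS T hT hne => ?_⟩
  · rw [Finset.union_comm]
    exact hsub S hS
  · exact (xor_comm _ _).mp (hx S hS T hT hne)

/-- Members through a common point of `A` are pairwise disjoint in `B`, so a member of the family
meets at most `k` of them in `B`. -/
theorem card_filter_inter_le (h : IsSemiIntersecting2 n k A B 𝒮) {v : α} (hv : v ∈ A)
    {F : Finset (Finset α)} (hF : ∀ S ∈ F, S ∈ 𝒮 ∧ v ∈ S) {T : Finset α} (hT : T ∈ 𝒮) :
    (F.filter (fun S => S ∩ T ∩ B ≠ ∅)).card ≤ k := by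
  obtain ⟨-, -, -, -, hk, hx⟩ := h
  rw [← (hk T hT).2]
  refine Finset.card_le_card_of_forall_subsingleton (fun S b => b ∈ S) ?_ ?_
  · intro S hS
    obtain ⟨b, hb⟩ := Finset.nonempty_iff_ne_empty.mpr (Finset.mem_filter.mp hS).2
    simp only [Finset.mem_inter] at hb
    exact ⟨b, Finset.mem_inter.mpr ⟨hb.1.2, hb.2⟩, hb.1.1⟩
  · rintro b hb S ⟨hS, hbS⟩ S' ⟨hS', hbS'⟩
    have hSF := hF S (Finset.mem_filter.mp hS).1
    have hSF' := hF S' (Finset.mem_filter.mp hS').1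
    by_contra hne
    rcases hx S hSF.1 S' hSF'.1 hne with h1 | h1
    · have : v ∈ S ∩ S' ∩ A := by simp [hSF.2, hSF'.2, hv]
      simp [h1.1] at this
    · have : b ∈ S ∩ S' ∩ B := by simp [hbS, hbS', (Finset.mem_inter.mp hb).2]
      simp [h1.1] at this

/-- If some point of `A` has degree more than `k`, then at most `k ^ 2` points of `A` meet all
members of the family. -/
theorem exists_hitting_set (h : IsSemiIntersecting2 n k A B 𝒮) {v : α} (hv : v ∈ A)
    (hdeg : k < (𝒮.filter (fun S => v ∈ S)).card) :
    ∃ X ⊆ A, X.card ≤ k ^ 2 ∧ ∀ T ∈ 𝒮, ∃ x ∈ X, x ∈ T := by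
  obtain ⟨F, hFsub, hFcard⟩ := Finset.exists_subset_card_eq (Nat.succ_le_of_lt hdeg)
  have hF : ∀ S ∈ F, S ∈ 𝒮 ∧ v ∈ S := fun S hS => Finset.mem_filter.mp (hFsub hS)
  obtain ⟨-, -, -, -, hk, hx⟩ := id h
  have hvX : ∀ S ∈ F, v ∈ S ∩ A := fun S hS => Finset.mem_inter.mpr ⟨(hF S hS).2, hv⟩
  refine ⟨insert v (F.biUnion fun S => (S ∩ A).erase v), ?_, ?_, ?_⟩
  · intro x hx
    simp only [Finset.mem_insert, Finset.mem_biUnion, Finset.mem_erase, Finset.mem_inter] at hx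
    rcases hx with rfl | ⟨S, -, -, -, hxA⟩
    exacts [hv, hxA]
  · have hb : (F.biUnion fun S => (S ∩ A).erase v).card ≤ F.card * (k - 1) :=
      Finset.card_biUnion_le_card_mul _ _ _ fun S hS => by
        rw [Finset.card_erase_of_mem (hvX S hS), (hk S (hF S hS).1).1]
    obtain ⟨S, hS⟩ : F.Nonempty := Finset.card_pos.mp (by omega)
    have hkpos : 0 < k := by
      rw [← (hk S (hF S hS).1).1]
      exact Finset.card_pos.mpr ⟨v, hvX S hS⟩
    obtain ⟨m, rfl⟩ := Nat.exists_eq_succ_of_ne_zero hkpos.ne'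
    have hi := Finset.card_insert_le v (F.biUnion fun S => (S ∩ A).erase v)
    rw [hFcard] at hb
    simp only [Nat.succ_eq_add_one, Nat.add_sub_cancel] at hb hi ⊢
    nlinarith
  · intro T hT
    by_cases hvT : v ∈ T
    · exact ⟨v, Finset.mem_insert_self _ _, hvT⟩
    obtain ⟨S, hS, hST⟩ : ∃ S ∈ F, S ∩ T ∩ B = ∅ := by
      by_contra! hne
      have hle := h.card_filter_inter_le hv hF hT
      rw [Finset.filter_true_of_mem (fun S hS => Finset.nonempty_iff_ne_empty.mp (by
        simpa [Finset.nonempty_iff_ne_empty] using hne S hS))] at hle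
      omega
    have hne : S ≠ T := fun he => hvT (he ▸ (hF S hS).2)
    have hA : S ∩ T ∩ A ≠ ∅ := by
      rcases hx S (hF S hS).1 T hT hne with h1 | h1
      exacts [absurd hST h1.2, h1.2]
    obtain ⟨a, ha⟩ := Finset.nonempty_iff_ne_empty.mpr hA
    simp only [Finset.mem_inter] at ha
    refine ⟨a, Finset.mem_insert_of_mem (Finset.mem_biUnion.mpr ⟨S, hS, ?_⟩), ha.1.2⟩
    exact Finset.mem_erase.mpr
      ⟨fun he => hvT (he ▸ ha.1.2), Finset.mem_inter.mpr ⟨ha.1.1, ha.2⟩⟩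

/-- If some degree in `A` exceeds `k`, then the family has at most `k ^ 2` times the maximum
degree in `A` many members. -/
theorem card_le_of_degree_le (h : IsSemiIntersecting2 n k A B 𝒮) {v : α} (hv : v ∈ A)
    (hdeg : k < (𝒮.filter (fun S => v ∈ S)).card) {D : ℕ}
    (hD : ∀ w ∈ A, (𝒮.filter (fun S => w ∈ S)).card ≤ D) : 𝒮.card ≤ k ^ 2 * D := by
  obtain ⟨X, hXA, hXcard, hX⟩ := h.exists_hitting_set hv hdeg
  have hsub : 𝒮 ⊆ X.biUnion fun x => 𝒮.filter (fun S => x ∈ S) := by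
    intro T hT
    obtain ⟨x, hx, hxT⟩ := hX T hT
    exact Finset.mem_biUnion.mpr ⟨x, hx, Finset.mem_filter.mpr ⟨hT, hxT⟩⟩
  calc 𝒮.card ≤ X.card * D := (Finset.card_le_card hsub).trans
        (Finset.card_biUnion_le_card_mul _ _ _ fun x hx => hD x (hXA hx))
    _ ≤ k ^ 2 * D := Nat.mul_le_mul_right _ hXcard

/-- Double counting of the pairs formed by a member through `v` and a member through `u`,
according to the side on which they meet. -/
theorem degree_mul_degree_le (h : IsSemiIntersecting2 n k A B 𝒮) {v u : α} (hv : v ∈ A)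
    (hu : u ∈ B) :
    (𝒮.filter (fun S => v ∈ S)).card * (𝒮.filter (fun S => u ∈ S)).card ≤
      (𝒮.filter (fun S => v ∈ S)).card * k + (𝒮.filter (fun S => u ∈ S)).card * k := by
  set F := 𝒮.filter (fun S => v ∈ S)
  set E := 𝒮.filter (fun S => u ∈ S)
  have hF : ∀ S ∈ F, S ∈ 𝒮 ∧ v ∈ S := fun S hS => Finset.mem_filter.mp hS
  have hE : ∀ S ∈ E, S ∈ 𝒮 ∧ u ∈ S := fun S hS => Finset.mem_filter.mp hS
  have hx := h.2.2.2.2.2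
  have hsplit : F.card * E.card = ∑ S ∈ F, (E.filter (fun T => T ∩ S ∩ A ≠ ∅)).card +
      ∑ S ∈ F, (E.filter (fun T => ¬ T ∩ S ∩ A ≠ ∅)).card := by
    rw [← Finset.sum_add_distrib]
    simp only [Finset.card_filter_add_card_filter_not, Finset.sum_const, smul_eq_mul]
  have hswap : ∑ S ∈ F, (E.filter (fun T => ¬ T ∩ S ∩ A ≠ ∅)).card =
      ∑ T ∈ E, (F.filter (fun S => ¬ T ∩ S ∩ A ≠ ∅)).card :=
    Finset.sum_card_bipartiteAbove_eq_sum_card_bipartiteBelow (fun S T => ¬ T ∩ S ∩ A ≠ ∅)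
  rw [hsplit, hswap]
  refine add_le_add (Finset.sum_le_card_nsmul _ _ _ fun S hS => ?_)
    (Finset.sum_le_card_nsmul _ _ _ fun T hT => ?_)
  · exact h.symm.card_filter_inter_le hu hE (hF S hS).1
  · refine le_trans (Finset.card_le_card fun S hS => ?_)
      (h.card_filter_inter_le hv hF (hE T hT).1)
    obtain ⟨hSF, hST⟩ := Finset.mem_filter.mp hS
    rw [not_not, Finset.inter_comm T S] at hST
    refine Finset.mem_filter.mpr ⟨hSF, ?_⟩
    have hne : S ≠ T := by
      rintro rfl
      have : v ∈ S ∩ S ∩ A := by simp [(hF S hSF).2, hv]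
      rw [hST] at this
      exact Finset.notMem_empty _ this
    rcases hx S (hF S hSF).1 T (hE T hT).1 hne with h1 | h1
    exacts [h1.2, absurd hST h1.2]

end IsSemiIntersecting2

/-- If a 2-semi-intersecting family has more than `2k³` members, then either all
degrees in `A` are at most `k`, or all degrees in `B` are at most `k`. -/
theorem stmt_5 {α : Type*} [DecidableEq α] (n k : ℕ)
    (A B : Finset α) (𝒮 : Finset (Finset α))
    (h : IsSemiIntersecting2 n k A B 𝒮)
    (hcard : 2 * k ^ 3 < 𝒮.card) :
    (∀ v ∈ A, (𝒮.filter (fun S => v ∈ S)).card ≤ k) ∨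
    (∀ v ∈ B, (𝒮.filter (fun S => v ∈ S)).card ≤ k) := by
  by_contra! hcon
  obtain ⟨⟨v, hv, hvdeg⟩, u, hu, hudeg⟩ := hcon
  have hA : ∃ w ∈ A, 2 * k < (𝒮.filter (fun S => w ∈ S)).card := by
    by_contra! hD
    have := h.card_le_of_degree_le hv hvdeg hD
    nlinarith
  have hB : ∃ w ∈ B, 2 * k < (𝒮.filter (fun S => w ∈ S)).card := by
    by_contra! hD
    have := h.symm.card_le_of_degree_le hu hudeg hD
    nlinarith
  obtain ⟨a, ha, hadeg⟩ := hA
  obtain ⟨b, hb, hbdeg⟩ := hB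
  have := h.degree_mul_degree_le ha hb
  nlinarith
end

section
/- Let ℓ ≥ 3 and let A_1, …, A_ℓ be pairwise disjoint finite sets with |A_i| ≥ 2 for every i, and union V. Then there exists a family 𝒮 of subsets of V with |𝒮| ≥ |V| − 2ℓ − 1 such that |S ∩ A_i| = 1 for every S ∈ 𝒮 and every i, and for any two distinct S, T ∈ 𝒮 the number of indices i with S ∩ T ∩ A_i = ∅ is odd. -/
/-- `𝒮` is a family of subsets of `V = A 0 ∪ … ∪ A (ℓ-1)` such that `|S ∩ A i| = 1` for all
`S ∈ 𝒮` and all `i`, and for distinct `S, T ∈ 𝒮` the number of indices `i` with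
`S ∩ T ∩ A i = ∅` is odd. -/
def IsXorSystem {α : Type*} [DecidableEq α] (ℓ : ℕ)
    (A : Fin ℓ → Finset α) (𝒮 : Finset (Finset α)) : Prop :=
  (∀ S ∈ 𝒮, S ⊆ Finset.univ.biUnion A) ∧
  (∀ S ∈ 𝒮, ∀ i, (S ∩ A i).card = 1) ∧
  (∀ S ∈ 𝒮, ∀ T ∈ 𝒮, S ≠ T →
    Odd ((Finset.univ.filter (fun i => S ∩ T ∩ A i = ∅)).card))

/-- Off-diagonal entries over `ZMod 2` may be changed symmetrically so as to obtain prescribed row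
sums with the correct total. -/
theorem exists_symmetric_correction {ι : Type*} [DecidableEq ι] (s : Finset ι)
    (Q : ι → ι → ZMod 2) (u : ι → ZMod 2) (hQ : ∀ i, Q i i = 0)
    (hsum : ∑ i ∈ s, ∑ j ∈ s, Q i j = ∑ i ∈ s, u i) :
    ∃ P : ι → ι → ZMod 2, (∀ i, P i i = 0) ∧ (∀ i ∈ s, ∑ j ∈ s, P i j = u i) ∧
      ∀ i j, P i j + P j i = Q i j + Q j i := by
  rcases s.eq_empty_or_nonempty with rfl | ⟨o, ho⟩
  · exact ⟨Q, hQ, by simp, fun _ _ => rfl⟩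
  let e : ι → ZMod 2 := fun i => u i - ∑ j ∈ s, Q i j
  have he : ∑ i ∈ s, e i = 0 := by simp [e, Finset.sum_sub_distrib, hsum]
  refine ⟨fun i j => Q i j + ((if j = o then e i else 0) + (if i = o then e j else 0)),
    fun i => ?_, fun i hi => ?_, fun i j => ?_⟩
  · simp only [hQ, zero_add]
    exact CharTwo.add_self_eq_zero _
  · by_cases h : i = o <;>
      simp [Finset.sum_add_distrib, h, ho, he, e]
  · linear_combination CharTwo.add_self_eq_zero (if j = o then e i else 0) +
      CharTwo.add_self_eq_zero (if i = o then e j else 0)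

theorem sum_sum_ite_lt_eq_choose {ι R : Type*} [LinearOrder ι] [CommSemiring R] (s : Finset ι) :
    ∑ i ∈ s, ∑ j ∈ s, (if i < j then (1 : R) else 0) = (s.card.choose 2 : ℕ) := by
  induction s using Finset.induction_on_max with
  | empty => simp
  | insert a s ha ih =>
    have hn : a ∉ s := fun h => lt_irrefl _ (ha a h)
    have h1 : ∑ j ∈ s, (if a < j then (1 : R) else 0) = 0 :=
      Finset.sum_eq_zero fun j hj => if_neg (ha j hj).not_gt
    have h2 : ∑ i ∈ s, (if i < a then (1 : R) else 0) = s.card := by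
      rw [Finset.sum_congr rfl fun i hi => if_pos (ha i hi)]
      simp
    simp only [Finset.sum_insert hn, Finset.sum_add_distrib, h1, h2, ih, lt_irrefl, if_false,
      Finset.card_insert_of_notMem hn, Nat.choose_succ_succ s.card 1, Nat.choose_one_right,
      Nat.cast_add, zero_add]

/-- A union of combinatorial lines, one in each direction, whose base points have odd distance
away from the two line directions, gives an xor-system. -/
theorem exists_isXorSystem_of_lines {α : Type*} [DecidableEq α] (ℓ : ℕ) (A : Fin ℓ → Finset α)
    (hdisj : ∀ i j, i ≠ j → Disjoint (A i) (A j)) (hA : ∀ i, (A i).Nonempty) (b : Fin ℓ → ℕ)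
    (hb : ∀ i, b i ≤ (A i).card) (p : Fin ℓ → Fin ℓ → ℕ)
    (hp : ∀ i k, i ≠ k → p i k < b k)
    (hodd : ∀ i j, i ≠ j →
      Odd (Finset.univ.filter fun k => k ≠ i ∧ k ≠ j ∧ p i k ≠ p j k).card) :
    ∃ 𝒮 : Finset (Finset α), IsXorSystem ℓ A 𝒮 ∧ 𝒮.card = ∑ i, ((A i).card - b i) := by
  let I : Finset (Σ _ : Fin ℓ, ℕ) := Finset.univ.sigma fun i => Finset.Ico (b i) (A i).card
  let w : (Σ _ : Fin ℓ, ℕ) → Fin ℓ → ℕ := fun z k => if k = z.1 then z.2 else p z.1 k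
  have hw : ∀ z ∈ I, ∀ k, w z k < (A k).card := by
    rintro ⟨i, x⟩ hz k
    simp only [I, Finset.mem_sigma, Finset.mem_univ, true_and, Finset.mem_Ico] at hz
    simp only [w]
    split_ifs with h
    · subst h; exact hz.2
    · exact (hp i k (Ne.symm h)).trans_le (hb k)
  have hdist : ∀ z ∈ I, ∀ z' ∈ I, z ≠ z' →
      Odd (Finset.univ.filter fun k => w z k ≠ w z' k).card := by
    rintro ⟨i, x⟩ hz ⟨j, y⟩ hz' hne
    simp only [I, Finset.mem_sigma, Finset.mem_univ, true_and, Finset.mem_Ico] at hz hz'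
    by_cases hij : i = j
    · subst hij
      have hxy : x ≠ y := fun h => hne (by rw [h])
      have : (Finset.univ.filter fun k => w ⟨i, x⟩ k ≠ w ⟨i, y⟩ k) = {i} := by
        ext k
        by_cases hk : k = i <;> simp [w, hk, hxy]
      simp [this]
    · have : (Finset.univ.filter fun k => w ⟨i, x⟩ k ≠ w ⟨j, y⟩ k) =
          insert i (insert j
            (Finset.univ.filter fun k => k ≠ i ∧ k ≠ j ∧ p i k ≠ p j k)) := by
        ext k
        have h1 := hp j i (Ne.symm hij)
        have h2 := hp i j hij
        by_cases hki : k = i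
        · subst hki
          simp [w, hij]; omega
        · by_cases hkj : k = j
          · subst hkj
            simp [w, hki]; omega
          · simp [w, hki, hkj]
      rw [this, Finset.card_insert_of_notMem (by simp [hij]),
        Finset.card_insert_of_notMem (by simp)]
      have := hodd i j hij
      grind
  have hf : ∀ k, ∃ f : ℕ → α, (∀ x < (A k).card, f x ∈ A k) ∧
      ∀ x < (A k).card, ∀ y < (A k).card, f x = f y → x = y := by
    intro k
    let g := (A k).equivFin.symm
    refine ⟨fun x => if h : x < (A k).card then g ⟨x, h⟩ else g ⟨0, (hA k).card_pos⟩, ?_, ?_⟩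
    · intro x hx
      simp [hx]
    · intro x hx y hy h
      simpa [hx, hy] using h
  choose f hfA hfi using hf
  let F : (Σ _ : Fin ℓ, ℕ) → Finset α := fun z => Finset.univ.image fun k => f k (w z k)
  have hF : ∀ z ∈ I, ∀ k, F z ∩ A k = {f k (w z k)} := by
    intro z hz k
    ext a
    simp only [F, Finset.mem_inter, Finset.mem_image, Finset.mem_univ, true_and,
      Finset.mem_singleton]
    constructor
    · rintro ⟨⟨m, rfl⟩, hm⟩
      by_cases hmk : m = k
      · rw [hmk]
      · exact absurd hm (Finset.disjoint_left.mp (hdisj m k hmk) (hfA m _ (hw z hz m)))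
    · rintro rfl
      exact ⟨⟨k, rfl⟩, hfA k _ (hw z hz k)⟩
  have hFF : ∀ z ∈ I, ∀ z' ∈ I, ∀ k, F z ∩ F z' ∩ A k = ∅ ↔ w z k ≠ w z' k := by
    intro z hz z' hz' k
    rw [Finset.inter_inter_distrib_right, hF z hz, hF z' hz', Finset.singleton_inter]
    have := hfi k _ (hw z hz k) _ (hw z' hz' k)
    split_ifs with h
    · simpa using this (by simpa using h)
    · simp only [true_iff]
      intro h'
      exact h (by simp [h'])
  have hinj : Set.InjOn F I := by
    intro z hz z' hz' h
    by_contra hne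
    obtain ⟨k, hk⟩ := Finset.card_pos.mp (hdist z hz z' hz' hne).pos
    have hk := (hFF z hz z' hz' k).mpr (Finset.mem_filter.mp hk).2
    rw [← h, Finset.inter_self, hF z hz] at hk
    simp at hk
  refine ⟨I.image F, ⟨?_, ?_, ?_⟩, ?_⟩
  · simp only [Finset.forall_mem_image]
    intro z hz a ha
    obtain ⟨k, -, rfl⟩ := Finset.mem_image.mp ha
    exact Finset.mem_biUnion.mpr ⟨k, Finset.mem_univ k, hfA k _ (hw z hz k)⟩
  · simp only [Finset.forall_mem_image]
    intro z hz k
    simp [hF z hz]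
  · simp only [Finset.forall_mem_image]
    intro z hz z' hz' hne
    simp only [hFF z hz z' hz']
    exact hdist z hz z' hz' fun h => hne (by rw [h])
  · rw [Finset.card_image_of_injOn hinj]
    simp [I]

theorem zmod_two_ite_val_ne (a b : ZMod 2) :
    (if a.val ≠ b.val then (1 : ZMod 2) else 0) = a + b := by
  revert a b; decide

/-- Base points with two values in each coordinate. -/
theorem exists_base_points {ℓ : ℕ} (hℓ : ℓ % 4 ≠ 2) :
    ∃ p : Fin ℓ → Fin ℓ → ℕ, (∀ i k, p i k < 2) ∧ ∀ i j, i ≠ j →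
      Odd (Finset.univ.filter fun k => k ≠ i ∧ k ≠ j ∧ p i k ≠ p j k).card := by
  obtain ⟨P, hP, hrow, hPP⟩ := exists_symmetric_correction (Finset.univ : Finset (Fin ℓ))
    (fun i j => if i < j then 1 else 0) (fun _ => (ℓ.choose 2 : ℕ)) (by simp) (by
      rw [sum_sum_ite_lt_eq_choose]
      simp only [Finset.card_univ, Fintype.card_fin, Finset.sum_const, nsmul_eq_mul]
      rcases Nat.even_or_odd ℓ with he | ho
      · have h : Even (ℓ.choose 2) := by
          obtain ⟨q, rfl⟩ : ∃ q, ℓ = 4 * q := ⟨ℓ / 4, by grind⟩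
          rw [Nat.choose_two_right, mul_assoc, show 4 * (q * (4 * q - 1)) =
            2 * (2 * (q * (4 * q - 1))) by ring, Nat.mul_div_cancel_left _ two_pos]
          exact even_two_mul _
        rw [(ZMod.natCast_eq_zero_iff_even).mpr h, mul_zero]
      · rw [(ZMod.natCast_eq_one_iff_odd (n := ℓ)).mpr ho, one_mul])
  refine ⟨fun i k => (P i k).val, fun i k => ZMod.val_lt _, fun i j hij => ?_⟩
  rw [← ZMod.natCast_eq_one_iff_odd, Finset.natCast_card_filter]
  have hterm : ∀ k, (if k ≠ i ∧ k ≠ j ∧ (P i k).val ≠ (P j k).val then (1 : ZMod 2) else 0) =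
      P i k + P j k + ((if k = i then P j i else 0) + (if k = j then P i j else 0)) := by
    intro k
    by_cases hi : k = i
    · subst hi; simp [hP, hij, CharTwo.add_self_eq_zero]
    · by_cases hj : k = j
      · subst hj; simp [hP, hi, CharTwo.add_self_eq_zero]
      · simpa [hi, hj] using zmod_two_ite_val_ne (P i k) (P j k)
  simp only [hterm, Finset.sum_add_distrib, hrow _ (Finset.mem_univ _), Finset.sum_ite_eq',
    Finset.mem_univ, if_true, CharTwo.add_self_eq_zero, zero_add]
  rw [hPP]
  rcases lt_or_gt_of_ne hij with h | h <;> simp [h, h.not_gt]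

/-- Base points with three values in one given coordinate and two in all the others. -/
theorem exists_base_points_of_mod_four_eq_two {ℓ : ℕ} (hℓ : ℓ % 4 = 2) (h3 : 3 ≤ ℓ)
    (o : Fin ℓ) :
    ∃ p : Fin ℓ → Fin ℓ → ℕ, (∀ i k, p i k < if k = o then 3 else 2) ∧ ∀ i j, i ≠ j →
      Odd (Finset.univ.filter fun k => k ≠ i ∧ k ≠ j ∧ p i k ≠ p j k).card := by
  obtain ⟨t, ht⟩ : ∃ t, t ∉ ({o} : Finset (Fin ℓ)) := by
    by_contra! h
    have := Finset.card_le_card (fun x _ => h x : Finset.univ ⊆ _)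
    simp at this; omega
  obtain ⟨t', ht'⟩ : ∃ t', t' ∉ ({o, t} : Finset (Fin ℓ)) := by
    by_contra! h
    have := (Finset.card_le_card (fun x _ => h x : Finset.univ ⊆ _)).trans Finset.card_le_two
    simp at this; omega
  simp only [Finset.mem_singleton, Finset.mem_insert, not_or] at ht ht'
  obtain ⟨hot', htt'⟩ := ht'
  let s : Finset (Fin ℓ) := Finset.univ.erase o
  let s' : Finset (Fin ℓ) := (s.erase t).erase t'
  have hs : s.card = ℓ - 1 := by simp [s]
  have hs' : s'.card = ℓ - 3 := by
    rw [Finset.card_erase_of_mem (by simp [s, hot', htt']),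
      Finset.card_erase_of_mem (by simp [s, ht]), hs]
    omega
  have hmem : ∀ i, i ∈ s' ↔ i ≠ t' ∧ i ≠ t ∧ i ≠ o := by simp [s', s]
  obtain ⟨Q, hQ, hrow, hQQ⟩ := exists_symmetric_correction s
    (fun i j => if i ∈ s' then if j ∈ s' then if i < j then 1 else 0 else 0 else 0)
    (fun _ => 1) (by simp) (by
      have hsub : s' ⊆ s := (Finset.erase_subset _ _).trans (Finset.erase_subset _ _)
      have : ∀ i, (∑ j ∈ s, if i ∈ s' then if j ∈ s' then if i < j then (1 : ZMod 2) else 0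
          else 0 else 0) = if i ∈ s' then ∑ j ∈ s', if i < j then (1 : ZMod 2) else 0 else 0 := by
        intro i
        split_ifs
        · rw [← Finset.sum_filter, Finset.filter_mem_eq_inter, Finset.inter_eq_right.mpr hsub]
        · simp
      simp only [this]
      rw [← Finset.sum_filter, Finset.filter_mem_eq_inter, Finset.inter_eq_right.mpr hsub,
        sum_sum_ite_lt_eq_choose, Finset.sum_const, nsmul_eq_mul, mul_one, hs, hs',
        ZMod.natCast_eq_one_iff_odd.mpr (show Odd (ℓ - 1) by grind),
        ZMod.natCast_eq_one_iff_odd]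
      obtain ⟨q, rfl⟩ : ∃ q, ℓ = 4 * q + 6 := ⟨(ℓ - 6) / 4, by omega⟩
      rw [Nat.choose_two_right, show 4 * q + 6 - 3 = 4 * q + 3 by omega,
        show (4 * q + 3) * (4 * q + 3 - 1) = 2 * ((4 * q + 3) * (2 * q + 1)) by
          rw [show 4 * q + 3 - 1 = 2 * (2 * q + 1) by omega]; ring,
        Nat.mul_div_cancel_left _ two_pos]
      exact Odd.mul ⟨2 * q + 1, by ring⟩ ⟨q, rfl⟩)
  let c : Fin ℓ → ℕ := fun i => if i = t then 1 else if i = t' then 2 else 0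
  let p : Fin ℓ → Fin ℓ → ℕ := fun i k =>
    if k = o then c i else if i = o then 0 else (Q i k).val
  have hsumo : ∀ g : Fin ℓ → ZMod 2, ∑ k, g k = g o + ∑ k ∈ s, g k := fun g =>
    (Finset.add_sum_erase _ _ (Finset.mem_univ o)).symm
  have hcast : ∀ i j, ((Finset.univ.filter fun k => k ≠ i ∧ k ≠ j ∧ p i k ≠ p j k).card : ZMod 2) =
      (if o ≠ i ∧ o ≠ j ∧ c i ≠ c j then 1 else 0) +
        ∑ k ∈ s, if k ≠ i ∧ k ≠ j ∧ p i k ≠ p j k then 1 else 0 := by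
    intro i j
    rw [Finset.natCast_card_filter, hsumo]
    simp [p]
  have base : ∀ j, j ≠ o →
      Odd (Finset.univ.filter fun k => k ≠ o ∧ k ≠ j ∧ p o k ≠ p j k).card := by
    intro j hj
    rw [← ZMod.natCast_eq_one_iff_odd, hcast]
    simp only [ne_eq, not_true_eq_false, false_and, if_false, zero_add]
    refine (Finset.sum_congr rfl fun k hk => ?_).trans (hrow j (by simp [s, hj]))
    have hk : k ≠ o := Finset.ne_of_mem_erase hk
    by_cases hkj : k = j
    · subst hkj; simp [hQ]
    · simpa [hk, hkj, p, hj] using zmod_two_ite_val_ne 0 (Q j k)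
  refine ⟨p, fun i k => ?_, fun i j hij => ?_⟩
  · simp only [p, c]
    have := ZMod.val_lt (Q i k)
    split_ifs <;> omega
  by_cases hi : i = o
  · subst hi; exact base j (Ne.symm hij)
  by_cases hj : j = o
  · subst hj
    simpa only [and_left_comm, ne_comm] using base i hij
  rw [← ZMod.natCast_eq_one_iff_odd, hcast]
  have hterm : ∀ k ∈ s, (if k ≠ i ∧ k ≠ j ∧ p i k ≠ p j k then (1 : ZMod 2) else 0) =
      Q i k + Q j k + ((if k = i then Q j i else 0) + (if k = j then Q i j else 0)) := by
    intro k hk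
    have hk : k ≠ o := Finset.ne_of_mem_erase hk
    by_cases hki : k = i
    · subst hki; simp [hQ, hij, CharTwo.add_self_eq_zero]
    · by_cases hkj : k = j
      · subst hkj; simp [hQ, hki, CharTwo.add_self_eq_zero]
      · simpa [hki, hkj, hk, p, hi, hj] using zmod_two_ite_val_ne (Q i k) (Q j k)
  have his : i ∈ s := by simp [s, hi]
  have hjs : j ∈ s := by simp [s, hj]
  rw [Finset.sum_congr rfl hterm]
  simp only [Finset.sum_add_distrib, hrow i his, hrow j hjs, Finset.sum_ite_eq', his, hjs,
    if_true, CharTwo.add_self_eq_zero, zero_add]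
  rw [hQQ]
  simp only [hmem, c]
  rcases lt_or_gt_of_ne hij with h | h <;> grind

/-- Clique-number lower bound for the xor-product of complete graphs: if `ℓ ≥ 3` and
all parts have at least two elements, there is such a family of size `≥ |V| − 2ℓ − 1`. -/
theorem stmt_9 {α : Type*} [DecidableEq α] (ℓ : ℕ) (hℓ : 3 ≤ ℓ)
    (A : Fin ℓ → Finset α)
    (hdisj : ∀ i j, i ≠ j → Disjoint (A i) (A j))
    (hcard : ∀ i, 2 ≤ (A i).card) :
    ∃ 𝒮 : Finset (Finset α), IsXorSystem ℓ A 𝒮 ∧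
      (Finset.univ.biUnion A).card - 2 * ℓ - 1 ≤ 𝒮.card := by
  have hA : ∀ i, (A i).Nonempty := fun i => Finset.card_pos.mp (by have := hcard i; omega)
  rw [Finset.card_biUnion fun i _ j _ => hdisj i j]
  have hsum : ∑ i, ((A i).card - 2) + 2 * ℓ = ∑ i, (A i).card := by
    rw [← Finset.sum_congr rfl fun i _ => Nat.sub_add_cancel (hcard i), Finset.sum_add_distrib]
    simp [mul_comm]
  by_cases hmod : ℓ % 4 = 2
  · by_cases hbig : ∃ o, 3 ≤ (A o).card
    · obtain ⟨o, ho⟩ := hbig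
      obtain ⟨p, hp, hodd⟩ := exists_base_points_of_mod_four_eq_two hmod hℓ o
      obtain ⟨𝒮, h𝒮, hc⟩ := exists_isXorSystem_of_lines ℓ A hdisj hA (fun k => if k = o then 3 else 2)
        (fun i => by split_ifs with h <;> simp [h, ho, hcard]) p (fun i k _ => hp i k) hodd
      refine ⟨𝒮, h𝒮, ?_⟩
      have : ∑ i, ((A i).card - 2) ≤
          ∑ i, ((A i).card - (if i = o then 3 else 2) + if i = o then 1 else 0) :=
        Finset.sum_le_sum fun i _ => by split_ifs <;> omega
      rw [Finset.sum_add_distrib, ← hc] at this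
      simp at this
      omega
    · push Not at hbig
      have : ∑ i, ((A i).card - 2) = 0 :=
        Finset.sum_eq_zero fun i _ => by have := hbig i; omega
      exact ⟨∅, by simp [IsXorSystem], by omega⟩
  · obtain ⟨p, hp, hodd⟩ := exists_base_points hmod
    obtain ⟨𝒮, h𝒮, hc⟩ := exists_isXorSystem_of_lines ℓ A hdisj hA (fun _ => 2) hcard p
      (fun i k _ => hp i k) hodd
    exact ⟨𝒮, h𝒮, by omega⟩
end

section
/- Let p, q ≥ 3. If there exists a p-core of type (x_1, …, x_p) and a q-core of type (y_1, …, y_q), then there exists a (p + q − 1)-core of type (x_1, …, x_{p−1}, x_p + y_1, y_2, …, y_q), provided the ambient parts are large enough to contain the required elements. -/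
/-- Given pairwise disjoint parts `A 0, …, A (ℓ-1)`, an `ℓ`-core is a family
`B 0, …, B (ℓ-1)` such that each `B i` has `ℓ − 1` elements, `B i ∩ A i = ∅`,
`|B i ∩ A j| = 1` for `j ≠ i`, and `|B i ∩ B j| ≢ ℓ (mod 2)` for all `i, j`. -/
def IsCore {α : Type*} [DecidableEq α] (ℓ : ℕ)
    (A B : Fin ℓ → Finset α) : Prop :=
  (∀ i, (B i).card = ℓ - 1) ∧
  (∀ i, B i ∩ A i = ∅) ∧
  (∀ i j, i ≠ j → (B i ∩ A j).card = 1) ∧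
  (∀ i j, ¬ ((B i ∩ B j).card ≡ ℓ [MOD 2]))

/-- A copy inside `ℕ` of the disjoint union of two finite sets of natural numbers. -/
def natDisjSum (S T : Finset ℕ) : Finset ℕ :=
  (S.disjSum T).map Equiv.natSumNatEquivNat.toEmbedding

theorem card_natDisjSum (S T : Finset ℕ) : (natDisjSum S T).card = S.card + T.card := by
  simp [natDisjSum]

theorem natDisjSum_inter (S T S' T' : Finset ℕ) :
    natDisjSum S T ∩ natDisjSum S' T' = natDisjSum (S ∩ S') (T ∩ T') := by
  unfold natDisjSum
  rw [← Finset.map_inter]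
  congr 1
  ext (z | z) <;> simp

theorem natDisjSum_empty : natDisjSum ∅ ∅ = ∅ := by
  simp [natDisjSum]

theorem biUnion_natDisjSum {ι κ μ : Type*} [Fintype ι] [Fintype κ] [Fintype μ]
    (C : κ → Finset ℕ) (D : μ → Finset ℕ) {a : ι → κ} {b : ι → μ}
    (ha : a.Surjective) (hb : b.Surjective) :
    (Finset.univ.biUnion fun i => natDisjSum (C (a i)) (D (b i))) =
      natDisjSum (Finset.univ.biUnion C) (Finset.univ.biUnion D) := by
  ext n
  obtain ⟨z, rfl⟩ := Equiv.natSumNatEquivNat.surjective n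
  rcases z with z | z
  · simp [natDisjSum, -Equiv.natSumNatEquivNat_apply, ha.exists]
  · simp [natDisjSum, -Equiv.natSumNatEquivNat_apply, hb.exists]

/-- Fusion lemma: from a `p`-core of type `(x_1, …, x_p)` and a `q`-core of type
`(y_1, …, y_q)` one obtains a `(p + q − 1)`-core of type
`(x_1, …, x_{p−1}, x_p + y_1, y_2, …, y_q)`. -/
theorem stmt_11 (p q : ℕ) (hp : 3 ≤ p) (hq : 3 ≤ q)
    (x : Fin p → ℕ) (y : Fin q → ℕ)
    (h1 : ∃ (A B : Fin p → Finset ℕ),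
      (∀ i j, i ≠ j → Disjoint (A i) (A j)) ∧ IsCore p A B ∧
      (∀ i, ((Finset.univ.biUnion B) ∩ A i).card = x i))
    (h2 : ∃ (A B : Fin q → Finset ℕ),
      (∀ i j, i ≠ j → Disjoint (A i) (A j)) ∧ IsCore q A B ∧
      (∀ i, ((Finset.univ.biUnion B) ∩ A i).card = y i)) :
    ∃ (A B : Fin (p + q - 1) → Finset ℕ),
      (∀ i j, i ≠ j → Disjoint (A i) (A j)) ∧ IsCore (p + q - 1) A B ∧
      (∀ i : Fin (p + q - 1),
        ((Finset.univ.biUnion B) ∩ A i).card =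
          if hlt : (i : ℕ) < p - 1 then x ⟨(i : ℕ), by omega⟩
          else if heq : (i : ℕ) = p - 1 then
            x ⟨p - 1, by omega⟩ + y ⟨0, by omega⟩
          else y ⟨(i : ℕ) - (p - 1), by have := i.isLt; omega⟩) := by
  obtain ⟨X, C, hX, ⟨hCcard, hCself, hCone, hCpar⟩, hx⟩ := h1
  obtain ⟨Y, D, hY, ⟨hDcard, hDself, hDone, hDpar⟩, hy⟩ := h2
  simp only [Finset.disjoint_iff_inter_eq_empty] at hX hY
  let a : Fin (p + q - 1) → Fin p := fun k => ⟨min k (p - 1), by omega⟩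
  let b : Fin (p + q - 1) → Fin q := fun k => ⟨k - (p - 1), by omega⟩
  have ha : a.Surjective := fun i => ⟨⟨i, by omega⟩, Fin.ext (by simp only [a]; omega)⟩
  have hb : b.Surjective := fun i => ⟨⟨i + (p - 1), by omega⟩, Fin.ext (by simp only [b]; omega)⟩
  have haeq : ∀ i j, a i = a j ↔ min (i : ℕ) (p - 1) = min (j : ℕ) (p - 1) := by
    simp [a]
  have hbeq : ∀ i j, b i = b j ↔ (i : ℕ) - (p - 1) = (j : ℕ) - (p - 1) := by
    simp [b]
  let P : Fin (p + q - 1) → Finset ℕ := fun k => if (k : ℕ) ≤ p - 1 then X (a k) else ∅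
  let Q : Fin (p + q - 1) → Finset ℕ := fun k => if p ≤ (k : ℕ) + 1 then Y (b k) else ∅
  refine ⟨fun k => natDisjSum (P k) (Q k), fun k => natDisjSum (C (a k)) (D (b k)),
    ?_, ⟨?_, ?_, ?_, ?_⟩, ?_⟩
  · intro i j hij
    have hXij : P i ∩ P j = ∅ := by
      by_cases hi : (i : ℕ) ≤ p - 1 <;> by_cases hj : (j : ℕ) ≤ p - 1 <;> simp [P, hi, hj]
      exact hX _ _ (by rw [Ne, haeq]; omega)
    have hYij : Q i ∩ Q j = ∅ := by
      by_cases hi : p ≤ (i : ℕ) + 1 <;> by_cases hj : p ≤ (j : ℕ) + 1 <;> simp [Q, hi, hj]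
      exact hY _ _ (by rw [Ne, hbeq]; omega)
    rw [Finset.disjoint_iff_inter_eq_empty, natDisjSum_inter, hXij, hYij, natDisjSum_empty]
  · intro i
    rw [card_natDisjSum, hCcard, hDcard]
    omega
  · intro i
    have hXi : C (a i) ∩ P i = ∅ := by
      by_cases hi : (i : ℕ) ≤ p - 1 <;> simp [P, hi, hCself]
    have hYi : D (b i) ∩ Q i = ∅ := by
      by_cases hi : p ≤ (i : ℕ) + 1 <;> simp [Q, hi, hDself]
    rw [natDisjSum_inter, hXi, hYi, natDisjSum_empty]
  · intro i j hij
    have hCP : (C (a i) ∩ P j).card =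
        if (j : ℕ) ≤ p - 1 ∧ a i ≠ a j then 1 else 0 := by
      by_cases hj : (j : ℕ) ≤ p - 1 <;> by_cases h : a i = a j <;>
        simp [P, hj, h, hCself, hCone]
    have hDQ : (D (b i) ∩ Q j).card =
        if p ≤ (j : ℕ) + 1 ∧ b i ≠ b j then 1 else 0 := by
      by_cases hj : p ≤ (j : ℕ) + 1 <;> by_cases h : b i = b j <;>
        simp [Q, hj, h, hDself, hDone]
    simp only [natDisjSum_inter, card_natDisjSum, hCP, hDQ, ne_eq, haeq, hbeq]
    split_ifs <;> omega
  · intro i j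
    have hC := hCpar (a i) (a j)
    have hD := hDpar (b i) (b j)
    rw [natDisjSum_inter, card_natDisjSum]
    unfold Nat.ModEq at *
    omega
  · intro i
    rw [biUnion_natDisjSum C D ha hb, natDisjSum_inter, card_natDisjSum]
    rcases lt_trichotomy (i : ℕ) (p - 1) with h | h | h
    · have hai : a i = ⟨i, by omega⟩ := Fin.ext (by simp only [a]; omega)
      have hpi : ¬ p ≤ (i : ℕ) + 1 := by omega
      simp [P, Q, h, h.le, hpi, hx, hai]
    · have hai : a i = ⟨p - 1, by omega⟩ := Fin.ext (by simp only [a]; omega)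
      have hbi : b i = ⟨0, by omega⟩ := Fin.ext (by simp only [b]; omega)
      have hpi : p ≤ p - 1 + 1 := by omega
      simp [P, Q, h, hpi, hx, hy, hai, hbi]
    · have hpi : p ≤ (i : ℕ) + 1 := by omega
      simp [P, Q, hpi, h.not_ge, h.not_gt, h.ne', hy, b]
end

section
/- For every ℓ ≥ 3 and pairwise disjoint sets A_1, …, A_ℓ with |A_i| ≥ 2 for all i and max_i |A_i| ≥ 3, there exists an ℓ-core ℬ with |U(ℬ)| ≤ 2ℓ + 1. -/
/-- A table of symbols, indexed by rows and columns, in which any two rows of the leading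
`ℓ × ℓ` block disagree in an odd number of off-diagonal columns when `ℓ / 2` has the parity
prescribed by `b`. Only column `2` may use a third symbol. -/
def coreTable (b : Bool) (i j : ℕ) : ℕ :=
  if i = 0 then
    if b ∧ j = 1 then 0 else if b ∧ j = 2 then 2 else j % 2
  else if j = 0 then (i + 1) % 2
  else if j < i then 1 else 0

lemma coreTable_lt_two (b : Bool) (i : ℕ) {j : ℕ} (hj : j ≠ 2) : coreTable b i j < 2 := by
  unfold coreTable
  split_ifs <;> grind

lemma coreTable_lt_three (b : Bool) (i j : ℕ) : coreTable b i j < 3 := by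
  unfold coreTable
  split_ifs <;> omega

lemma card_coreTable_ne_of_pos (b : Bool) {i k : ℕ} (hi : 0 < i) (hik : i < k) (n : ℕ) :
    ((Finset.range n).filter
      fun j => j ≠ i ∧ j ≠ k ∧ coreTable b i j ≠ coreTable b k j).card =
      if n = 0 then 0 else (i + k) % 2 +
        (if n ≤ i then 0 else if n ≤ k then n - i - 1 else k - i - 1) := by
  induction n with
  | zero => simp
  | succ n ih =>
    rw [Finset.range_add_one, Finset.filter_insert,
      apply_ite Finset.card, Finset.card_insert_of_notMem (by simp), ih]
    unfold coreTable
    grind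

lemma card_coreTable_zero_ne (b : Bool) {k : ℕ} (hk : 0 < k) (n : ℕ) :
    ((Finset.range n).filter
      fun j => j ≠ 0 ∧ j ≠ k ∧ coreTable b 0 j ≠ coreTable b k j).card =
      (if n ≤ k then (n - 1) / 2 else (k - 1) / 2 + (n / 2 - (k + 1) / 2)) +
        (if b ∧ ((1 < k ∧ 1 < n) ∨ (k = 1 ∧ 2 < n)) then 1 else 0) := by
  induction n with
  | zero => simp
  | succ n ih =>
    rw [Finset.range_add_one, Finset.filter_insert,
      apply_ite Finset.card, Finset.card_insert_of_notMem (by simp), ih]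
    unfold coreTable
    cases b <;> grind

lemma odd_card_coreTable_ne {ℓ : ℕ} (hℓ : 3 ≤ ℓ) {i k : ℕ} (hik : i < k) (hk : k < ℓ) :
    ((Finset.range ℓ).filter fun j => j ≠ i ∧ j ≠ k ∧
      coreTable (decide (ℓ / 2 % 2 = 1)) i j ≠
        coreTable (decide (ℓ / 2 % 2 = 1)) k j).card % 2 = 1 := by
  rcases Nat.eq_zero_or_pos i with rfl | hi
  · rw [card_coreTable_zero_ne _ hik]
    simp only [decide_eq_true_eq]
    split_ifs <;> omega
  · rw [card_coreTable_ne_of_pos _ hi hik]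
    split_ifs <;> omega

/-- The table of `coreTable` with its columns relabelled so that any prescribed column `z` is the
one using a third symbol, phrased in terms of agreements of rows. -/
lemma exists_table {ℓ : ℕ} (hℓ : 3 ≤ ℓ) (z : Fin ℓ) :
    ∃ g : Fin ℓ → Fin ℓ → ℕ, (∀ i j, g i j < if j = z then 3 else 2) ∧
      ∀ i k, i ≠ k → ¬ ((Finset.univ.filter
        fun j => j ≠ i ∧ j ≠ k ∧ g i j = g k j).card ≡ ℓ [MOD 2]) := by
  set b := decide (ℓ / 2 % 2 = 1)
  let σ : Equiv.Perm (Fin ℓ) := Equiv.swap z ⟨2, hℓ⟩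
  refine ⟨fun i j => coreTable b (σ i) (σ j), fun i j => ?_, fun i k hik => ?_⟩
  · split_ifs with h
    · exact coreTable_lt_three _ _ _
    · refine coreTable_lt_two _ _ fun h' => h ?_
      have : σ j = σ z := by
        rw [Equiv.swap_apply_left]
        exact Fin.ext h'
      exact σ.injective this
  · have hodd : (Finset.univ.filter fun j : Fin ℓ => j ≠ i ∧ j ≠ k ∧
        coreTable b (σ i) (σ j) ≠ coreTable b (σ k) (σ j)).card % 2 = 1 := by
      have hcard : (Finset.univ.filter fun j : Fin ℓ => j ≠ i ∧ j ≠ k ∧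
          coreTable b (σ i) (σ j) ≠ coreTable b (σ k) (σ j)).card =
          ((Finset.range ℓ).filter fun j => j ≠ (σ i : ℕ) ∧ j ≠ (σ k : ℕ) ∧
            coreTable b (σ i) j ≠ coreTable b (σ k) j).card := by
        refine Finset.card_bij (fun j _ => (σ j : ℕ)) ?_ ?_ ?_
        · intro j hj
          simpa [Fin.val_inj] using hj
        · intro j _ j' _ h
          exact σ.injective (Fin.ext h)
        · intro m hm
          obtain ⟨hm, h⟩ := Finset.mem_filter.1 hm
          have hm := Finset.mem_range.1 hm
          refine ⟨σ.symm ⟨m, hm⟩, ?_, by simp⟩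
          exact Finset.mem_filter.2 ⟨Finset.mem_univ _, fun h' => h.1 (by simp [← h']),
            fun h' => h.2.1 (by simp [← h']), by simpa using h.2.2⟩
      rw [hcard]
      have hne : (σ i : ℕ) ≠ σ k := fun h => hik (σ.injective (Fin.ext h))
      rcases hne.lt_or_gt with h | h
      · exact odd_card_coreTable_ne hℓ h (σ k).2
      · convert odd_card_coreTable_ne hℓ h (σ i).2 using 4
        grind
    have hsum := Finset.card_filter_add_card_filter_not (s := (Finset.univ.erase i).erase k)
      (fun j => coreTable b (σ i) (σ j) = coreTable b (σ k) (σ j))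
    rw [Finset.card_erase_of_mem (by simp [hik.symm]), Finset.card_erase_of_mem (by simp),
      Finset.card_univ, Fintype.card_fin] at hsum
    have heq : ∀ p : Fin ℓ → Prop, ∀ [DecidablePred p],
        ((Finset.univ.erase i).erase k).filter p =
          Finset.univ.filter fun j => j ≠ i ∧ j ≠ k ∧ p j := by
      intro p _
      ext j
      simp
      tauto
    rw [heq, heq] at hsum
    simp only [ne_eq, Nat.ModEq] at hodd hsum ⊢
    omega


/-- For every `ℓ ≥ 3` and pairwise disjoint parts with `|A i| ≥ 2` for all `i` and
`|A i| ≥ 3` for some `i`, there is an `ℓ`-core `ℬ` with `|U(ℬ)| ≤ 2ℓ + 1`. -/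
theorem stmt_12 {α : Type*} [DecidableEq α] (ℓ : ℕ) (hℓ : 3 ≤ ℓ)
    (A : Fin ℓ → Finset α)
    (hdisj : ∀ i j, i ≠ j → Disjoint (A i) (A j))
    (h2 : ∀ i, 2 ≤ (A i).card)
    (h3 : ∃ i, 3 ≤ (A i).card) :
    ∃ B : Fin ℓ → Finset α, IsCore ℓ A B ∧
      (Finset.univ.biUnion B).card ≤ 2 * ℓ + 1 := by
  obtain ⟨z, hz⟩ := h3
  obtain ⟨g, hg, hpar⟩ := exists_table hℓ z
  have hgA : ∀ i j, g i j < (A j).card := by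
    intro i j
    have := hg i j
    have := h2 j
    split_ifs at * with h
    · subst h; omega
    · omega
  have he : ∀ j, ∃ e : ℕ → α, (∀ v < (A j).card, e v ∈ A j) ∧
      ∀ v < (A j).card, ∀ w < (A j).card, e v = e w → v = w := by
    intro j
    have hpos : 0 < (A j).card := by have := h2 j; omega
    let φ := (A j).equivFin.symm
    refine ⟨fun v => if h : v < (A j).card then φ ⟨v, h⟩ else φ ⟨0, hpos⟩,
      fun v hv => by simp [hv], fun v hv w hw h => ?_⟩
    simpa [hv, hw, Subtype.val_inj] using h
  choose e he_mem he_inj using he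
  have hmem : ∀ i j, e j (g i j) ∈ A j := fun i j => he_mem j _ (hgA i j)
  have hpart : ∀ {j j' : Fin ℓ} {x : α}, x ∈ A j → x ∈ A j' → j = j' := by
    intro j j' x hx hx'
    by_contra h
    exact Finset.disjoint_left.1 (hdisj j j' h) hx hx'
  have hinj : ∀ i, Function.Injective fun j => e j (g i j) := by
    intro i j j' h
    exact hpart (hmem i j) ((show e j (g i j) = e j' (g i j') from h) ▸ hmem i j')
  refine ⟨fun i => (Finset.univ.erase i).image fun j => e j (g i j), ⟨?_, ?_, ?_, ?_⟩, ?_⟩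
  · intro i
    rw [Finset.card_image_of_injective _ (hinj i), Finset.card_erase_of_mem (by simp),
      Finset.card_univ, Fintype.card_fin]
  · intro i
    ext x
    simp only [Finset.mem_inter, Finset.mem_image, Finset.mem_erase, Finset.notMem_empty,
      iff_false]
    rintro ⟨⟨j, hj, rfl⟩, hx⟩
    exact hj.1 (hpart (hmem i j) hx)
  · intro i j hij
    rw [Finset.card_eq_one]
    refine ⟨e j (g i j), ?_⟩
    ext x
    simp only [Finset.mem_inter, Finset.mem_image, Finset.mem_erase, Finset.mem_singleton]
    constructor
    · rintro ⟨⟨j', -, rfl⟩, hx⟩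
      rw [hpart (hmem i j') hx]
    · rintro rfl
      exact ⟨⟨j, ⟨hij.symm, Finset.mem_univ _⟩, rfl⟩, hmem i j⟩
  · intro i k
    rcases eq_or_ne i k with rfl | hik
    · rw [Finset.inter_self, Finset.card_image_of_injective _ (hinj i),
        Finset.card_erase_of_mem (by simp), Finset.card_univ, Fintype.card_fin, Nat.ModEq]
      omega
    · have hinter : ((Finset.univ.erase i).image fun j => e j (g i j)) ∩
          ((Finset.univ.erase k).image fun j => e j (g k j)) =
          (Finset.univ.filter fun j => j ≠ i ∧ j ≠ k ∧ g i j = g k j).image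
            fun j => e j (g i j) := by
        ext x
        simp only [Finset.mem_inter, Finset.mem_image, Finset.mem_erase, Finset.mem_filter,
          Finset.mem_univ, and_true, true_and]
        constructor
        · rintro ⟨⟨j, hj, rfl⟩, j', hj', h⟩
          obtain rfl : j' = j := hpart (hmem k j') (h ▸ hmem i j)
          exact ⟨j', ⟨hj, hj', (he_inj j' _ (hgA k j') _ (hgA i j') h).symm⟩, rfl⟩
        · rintro ⟨j, ⟨hj, hj', h⟩, rfl⟩
          exact ⟨⟨j, hj, rfl⟩, j, hj', by rw [h]⟩
      rw [hinter, Finset.card_image_of_injective _ (hinj i)]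
      exact hpar i k hik
  · have hsub : (Finset.univ.biUnion fun i =>
        (Finset.univ.erase i).image fun j => e j (g i j)) ⊆
        Finset.univ.biUnion fun j => (Finset.range (if j = z then 3 else 2)).image (e j) := by
      intro x
      simp only [Finset.mem_biUnion, Finset.mem_image, Finset.mem_range, Finset.mem_univ,
        true_and]
      rintro ⟨i, j, -, rfl⟩
      exact ⟨j, g i j, hg i j, rfl⟩
    calc _ ≤ _ := Finset.card_le_card hsub
      _ ≤ ∑ j, ((Finset.range (if j = z then 3 else 2)).image (e j)).card :=
        Finset.card_biUnion_le
      _ ≤ ∑ j, (2 + if j = z then 1 else 0) := by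
        refine Finset.sum_le_sum fun j _ => Finset.card_image_le.trans ?_
        rw [Finset.card_range]
        split_ifs <;> rfl
      _ = 2 * ℓ + 1 := by
        rw [Finset.sum_add_distrib]
        simp [mul_comm]
end
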